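/- For every n ≥ 1, the chromatic number of the n-dimensional associahedron equals Σ_{i=2}^{⌈n/2⌉+1} A_i, i.e. α_n = Σ_{i=2}^{⌈n/2⌉+1} A_i. -/

import Mathlib

/-- A segment of `[n]₀ = {0,...,n}`: a set `[a,b] = {x : a ≤ x ≤ b}` with
`0 ≤ a ≤ b ≤ n` that is a proper subset of `[n]₀`. -/
def IsSegment (n : ℕ) (S : Finset ℕ) : Prop :=
  ∃ a b : ℕ, a ≤ b ∧ b ≤ n ∧ S = Finset.Icc a b ∧ S ⊂ Finset.range (n + 1)

/-- The segment `[a,b]` precedes the segment `[c,d]` when `a+1 ≤ c ≤ b+1` and `b < d`. -/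
def SegPrecedes (n : ℕ) (S T : Finset ℕ) : Prop :=
  ∃ a b c d : ℕ, a ≤ b ∧ b ≤ n ∧ c ≤ d ∧ d ≤ n ∧
    S = Finset.Icc a b ∧ T = Finset.Icc c d ∧ a + 1 ≤ c ∧ c ≤ b + 1 ∧ b < d

/-- Two segments are separated when one of them precedes the other. -/
def SegSeparated (n : ℕ) (S T : Finset ℕ) : Prop :=
  SegPrecedes n S T ∨ SegPrecedes n T S

/-- A proper colouring of the `n`-dimensional associahedron with `m` colours:
a function from the segments of `[n]₀` to `{1,...,m}` such that any two distinct
segments of the same colour are separated. -/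
def IsProperColouringAssoc (n m : ℕ) (f : Finset ℕ → ℕ) : Prop :=
  (∀ S, IsSegment n S → f S ∈ Finset.Icc 1 m) ∧
  ∀ S T, IsSegment n S → IsSegment n T → S ≠ T → f S = f T → SegSeparated n S T

/-- The chromatic number `α_n` of the `n`-dimensional associahedron: the least `m`
for which a proper colouring with `m` colours exists. -/
noncomputable def assocChromatic (n : ℕ) : ℕ :=
  sInf {m : ℕ | ∃ f : Finset ℕ → ℕ, IsProperColouringAssoc n m f}

/-- The pair `(A_i, B_i)` from the recursion (at argument `j`, the index is `i = j + 2`):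
`B₂ = 0`; `B_i = n + 3 + B_{i-1} - (i-1)·A_{i-1}` for `2 < i ≤ ⌈n/2⌉ + 1`;
`A_i = ⌈(n + 3 + B_i)/i⌉` if `n` is even or `i ≤ ⌈n/2⌉`, and `A_i = 1` if `n` is odd
and `i = ⌈n/2⌉ + 1`.  (Note `⌈n/2⌉ = (n+1)/2` in natural division.) -/
noncomputable def assocAB (n : ℕ) : ℕ → ℤ × ℤ
  | 0 =>
      (if n % 2 = 0 ∨ 2 ≤ (n + 1) / 2 then ⌈((n : ℚ) + 3) / 2⌉ else 1, 0)
  | j + 1 =>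
      let p := assocAB n j
      let B : ℤ := (n : ℤ) + 3 + p.2 - ((j : ℤ) + 2) * p.1
      (if n % 2 = 0 ∨ j + 3 ≤ (n + 1) / 2 then
          ⌈((n : ℚ) + 3 + (B : ℚ)) / ((j : ℚ) + 3)⌉
        else 1, B)

/-- `A_i` from the recursion above, for `i ≥ 2`. -/
noncomputable def assocA (n i : ℕ) : ℤ := (assocAB n (i - 2)).1

namespace AssocAux

/-- `(a, c)` is a diagonal of the `N`-gon with vertices `0, ..., N-1`. -/
def IsD (N : ℕ) (d : ℕ × ℕ) : Prop :=
  d.1 + 2 ≤ d.2 ∧ d.2 < N ∧ (1 ≤ d.1 ∨ d.2 + 1 < N)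

/-- Oriented crossing of diagonals. -/
def Cr (d e : ℕ × ℕ) : Prop := d.1 < e.1 ∧ e.1 < d.2 ∧ d.2 < e.2

/-- The segment of a diagonal. -/
def seg (d : ℕ × ℕ) : Finset ℕ := Finset.Icc d.1 (d.2 - 2)

theorem icc_inj {a b c d : ℕ} (h : a ≤ b) (h' : c ≤ d) (e : Finset.Icc a b = Finset.Icc c d) :
    a = c ∧ b = d := by
  have h1 : a ∈ Finset.Icc c d := by rw [← e]; simp [h]
  have h2 : b ∈ Finset.Icc c d := by rw [← e]; simp [h]
  have h3 : c ∈ Finset.Icc a b := by rw [e]; simp [h']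
  have h4 : d ∈ Finset.Icc a b := by rw [e]; simp [h']
  simp only [Finset.mem_Icc] at *
  omega

theorem isSegment_iff (n : ℕ) (S : Finset ℕ) :
    IsSegment n S ↔ ∃ d, IsD (n + 3) d ∧ S = seg d := by
  constructor
  · rintro ⟨a, b, hab, hb, rfl, hS⟩
    refine ⟨(a, b + 2), ⟨by simp; omega, by simp; omega, ?_⟩, by simp [seg]⟩
    by_contra hcon
    simp only [not_or] at hcon
    apply hS.2
    intro x hx
    simp only [Finset.mem_range, Finset.mem_Icc] at *
    omega
  · rintro ⟨⟨a, c⟩, ⟨h1, h2, h3⟩, rfl⟩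
    simp only at h1 h2 h3
    refine ⟨a, c - 2, by omega, by omega, rfl, ?_⟩
    rw [Finset.ssubset_iff_subset_ne]
    constructor
    · intro x hx
      simp only [seg, Finset.mem_range, Finset.mem_Icc] at *
      omega
    · intro e
      have h0 : 0 ∈ seg (a, c) := by rw [e]; simp
      have h0' : n ∈ seg (a, c) := by rw [e]; simp
      simp only [seg, Finset.mem_Icc] at *
      omega

theorem precedes_iff (n : ℕ) (d e : ℕ × ℕ) (hd : IsD (n + 3) d) (he : IsD (n + 3) e) :
    SegPrecedes n (seg d) (seg e) ↔ Cr d e := by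
  obtain ⟨h1, h2, -⟩ := hd
  obtain ⟨h3, h4, -⟩ := he
  unfold Cr
  constructor
  · rintro ⟨a, b, a', b', i1, i2, i3, i4, e1, e2, j1, j2, j3⟩
    obtain ⟨k1, k2⟩ := icc_inj (by omega) i1 e1
    obtain ⟨k3, k4⟩ := icc_inj (by omega) i3 e2
    omega
  · rintro ⟨i1, i2, i3⟩
    exact ⟨d.1, d.2 - 2, e.1, e.2 - 2, by omega, by omega, by omega, by omega, rfl, rfl,
      by omega, by omega, by omega⟩

theorem seg_inj {N : ℕ} {d e : ℕ × ℕ} (hd : IsD N d) (he : IsD N e) (h : seg d = seg e) :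
    d = e := by
  obtain ⟨h1, h2, -⟩ := hd
  obtain ⟨h3, h4, -⟩ := he
  obtain ⟨k1, k2⟩ := icc_inj (by omega) (by omega) h
  exact Prod.ext k1 (by omega)

/-- Colouring of diagonals. -/
def Col (N m : ℕ) (g : ℕ × ℕ → ℕ) : Prop :=
  (∀ d, IsD N d → g d < m) ∧
  ∀ d e, IsD N d → IsD N e → d ≠ e → g d = g e → Cr d e ∨ Cr e d

theorem exists_col_iff (n m : ℕ) :
    (∃ f, IsProperColouringAssoc n m f) ↔ ∃ g, Col (n + 3) m g := by
  constructor
  · rintro ⟨f, hf1, hf2⟩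
    refine ⟨fun d => f (seg d) - 1, fun d hd => ?_, fun d e hd he hne h => ?_⟩
    · have := hf1 (seg d) ((isSegment_iff _ _).2 ⟨d, hd, rfl⟩)
      simp only [Finset.mem_Icc] at *
      omega
    · have sd := (isSegment_iff n (seg d)).2 ⟨d, hd, rfl⟩
      have se := (isSegment_iff n (seg e)).2 ⟨e, he, rfl⟩
      have i1 := hf1 _ sd
      have i2 := hf1 _ se
      simp only [Finset.mem_Icc] at *
      have := hf2 _ _ sd se (fun h => hne (seg_inj hd he h)) (by omega)
      unfold SegSeparated at this
      rwa [precedes_iff n d e hd he, precedes_iff n e d he hd] at this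
  · rintro ⟨g, hg1, hg2⟩
    have key : ∀ d, IsD (n + 3) d →
        (fun S : Finset ℕ => g (sInf (S : Set ℕ), S.sup id + 2) + 1) (seg d) = g d + 1 := by
      rintro ⟨a, c⟩ ⟨h1, h2, -⟩
      simp only at h1 h2
      have e1 : sInf ((seg (a, c) : Finset ℕ) : Set ℕ) = a := by
        simp only [seg, Finset.coe_Icc]
        exact csInf_Icc (by omega)
      have e2 : (seg (a, c)).sup id = c - 2 := by
        apply le_antisymm
        · apply Finset.sup_le
          intro x hx
          simp only [seg, Finset.mem_Icc] at hx
          exact hx.2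
        · exact Finset.le_sup (f := id) (b := c - 2) (by simp [seg]; omega)
      simp only [e1, e2]
      congr 3
      omega
    refine ⟨fun S : Finset ℕ => g (sInf (S : Set ℕ), S.sup id + 2) + 1, ?_, ?_⟩
    · intro S hS
      obtain ⟨d, hd, rfl⟩ := (isSegment_iff _ _).1 hS
      rw [key d hd]
      have := hg1 d hd
      simp only [Finset.mem_Icc]
      omega
    · intro S T hS hT hne h
      obtain ⟨d, hd, rfl⟩ := (isSegment_iff _ _).1 hS
      obtain ⟨e, he, rfl⟩ := (isSegment_iff _ _).1 hT
      rw [key d hd, key e he] at h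
      unfold SegSeparated
      rw [precedes_iff n d e hd he, precedes_iff n e d he hd]
      exact hg2 d e hd he (fun h => hne (by rw [h])) (by omega)

/-- Number of diagonals of length at most `j + 2`. -/
def T (N j : ℕ) : ℕ := if 2 * (j + 2) < N then (j + 1) * N else j * N + (j + 2)

/-- Position of a diagonal in the list sorted by length. -/
def enc (N : ℕ) (d : ℕ × ℕ) : ℕ :=
  if 2 * (d.2 - d.1) ≤ N then (d.2 - d.1 - 2) * N + d.1 else (N - (d.2 - d.1) - 2) * N + d.2

/-- Length of a diagonal. -/
def len (N : ℕ) (d : ℕ × ℕ) : ℕ := min (d.2 - d.1) (N - (d.2 - d.1))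

theorem enc_lt (N j : ℕ) (hj : 2 * (j + 2) ≤ N) (hj' : N < 2 * (j + 3)) (d : ℕ × ℕ)
    (hd : IsD N d) : enc N d < T N j := by
  obtain ⟨a, c⟩ := d
  obtain ⟨h1, h2, h3⟩ := hd
  simp only at h1 h2 h3
  unfold enc T
  simp only
  obtain ⟨l, hl, hlj⟩ : ∃ l, (2 * (c - a) ≤ N → c - a - 2 = l) ∧
      (¬ 2 * (c - a) ≤ N → N - (c - a) - 2 = l) := by
    by_cases h : 2 * (c - a) ≤ N
    · exact ⟨c - a - 2, by simp [h]⟩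
    · exact ⟨N - (c - a) - 2, by simp [h]⟩
  have hlej : l ≤ j := by omega
  rcases Nat.lt_or_eq_of_le hlej with h | h
  · have : (l + 1) * N ≤ j * N := Nat.mul_le_mul_right _ h
    split_ifs with c1 c2 c2
    · rw [hl c1]; linarith
    · rw [hl c1]; linarith
    · rw [hlj c1]; linarith
    · rw [hlj c1]; linarith
  · subst h
    split_ifs with c1 c2 c2
    · rw [hl c1]; linarith
    · rw [hl c1]; have := hl c1; omega
    · rw [hlj c1]; linarith
    · exfalso; omega

theorem enc_cross (N j k : ℕ) (hj : 2 * j ≤ N) (hj2 : 2 ≤ j) (d e : ℕ × ℕ) (hd : IsD N d)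
    (he : IsD N e) (hk : (j - 2) * N ≤ k) (hk' : k < (j - 1) * N) (h1 : k ≤ enc N d)
    (h2 : enc N d < enc N e) (h3 : enc N e < k + j) : Cr d e ∨ Cr e d := by
  obtain ⟨i, rfl⟩ := Nat.exists_eq_add_of_le' hj2
  rw [show i + 2 - 1 = i + 1 by omega] at hk'
  rw [show i + 2 - 2 = i by omega] at hk
  have base : ∀ d, IsD N d → ∃ l s, enc N d = l * N + s ∧ s < N ∧
      ((s = d.1 ∧ d.2 = s + l + 2 ∧ 2 * (l + 2) ≤ N) ∨
       (s = d.2 ∧ s + l + 2 = d.1 + N ∧ 2 * (l + 2) < N)) := by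
    rintro ⟨a, c⟩ ⟨h1, h2, h3⟩
    simp only at h1 h2 h3
    unfold enc
    simp only
    split_ifs with c1
    · exact ⟨c - a - 2, a, rfl, by omega, Or.inl ⟨rfl, by omega, by omega⟩⟩
    · exact ⟨N - (c - a) - 2, c, rfl, by omega, Or.inr ⟨rfl, by omega, by omega⟩⟩
  obtain ⟨l, s, e1, hs, hc⟩ := base d hd
  obtain ⟨l', s', e2, hs', hc'⟩ := base e he
  rw [e1] at h1 h2
  rw [e2] at h2 h3
  have hl : i ≤ l := by
    by_contra hcon
    have : (l + 1) * N ≤ i * N := Nat.mul_le_mul_right _ (by omega)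
    linarith
  have hll : l ≤ l' := by
    by_contra hcon
    have : (l' + 1) * N ≤ l * N := Nat.mul_le_mul_right _ (by omega)
    linarith
  have hl' : l' ≤ i + 1 := by
    by_contra hcon
    have : (i + 2) * N ≤ l' * N := Nat.mul_le_mul_right _ (by omega)
    linarith
  have hcase : (l' = l ∧ s < s' ∧ s' < s + i + 2) ∨ (l = i ∧ l' = i + 1 ∧ s' + N < s + i + 2) := by
    rcases Nat.lt_or_eq_of_le hll with h | h
    · right
      have a1 : l = i := by omega
      have a2 : l' = i + 1 := by omega
      subst a1 a2
      refine ⟨rfl, rfl, ?_⟩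
      linarith
    · left
      subst h
      refine ⟨rfl, by omega, by omega⟩
  unfold Cr
  unfold IsD at hd he
  clear h1 h2 h3 e1 e2 hk hk' base
  omega

theorem enc_inj {N : ℕ} {d e : ℕ × ℕ} (hd : IsD N d) (he : IsD N e)
    (h : enc N d = enc N e) : d = e := by
  have base : ∀ d, IsD N d → ∃ l s, enc N d = l * N + s ∧ s < N ∧
      ((s = d.1 ∧ d.2 = s + l + 2 ∧ 2 * (l + 2) ≤ N) ∨
       (s = d.2 ∧ s + l + 2 = d.1 + N ∧ 2 * (l + 2) < N)) := by
    rintro ⟨a, c⟩ ⟨h1, h2, h3⟩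
    simp only at h1 h2 h3
    unfold enc
    simp only
    split_ifs with c1
    · exact ⟨c - a - 2, a, rfl, by omega, Or.inl ⟨rfl, by omega, by omega⟩⟩
    · exact ⟨N - (c - a) - 2, c, rfl, by omega, Or.inr ⟨rfl, by omega, by omega⟩⟩
  obtain ⟨l, s, e1, hs, hc⟩ := base d hd
  obtain ⟨l', s', e2, hs', hc'⟩ := base e he
  rw [e1, e2] at h
  have hll : l = l' := by
    rcases lt_trichotomy l l' with hl | hl | hl
    · have : (l + 1) * N ≤ l' * N := Nat.mul_le_mul_right _ hl
      linarith
    · exact hl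
    · have : (l' + 1) * N ≤ l * N := Nat.mul_le_mul_right _ hl
      linarith
  subst hll
  unfold IsD at hd he
  apply Prod.ext <;> omega

theorem exists_greedy (a : ℕ → ℕ) (J : ℕ) : ∃ c : ℕ → ℕ,
    (∀ t, t < ∑ l ∈ Finset.range J, (l + 2) * a l → c t < ∑ l ∈ Finset.range J, a l) ∧
    ∀ t t', t < t' → t' < ∑ l ∈ Finset.range J, (l + 2) * a l → c t = c t' →
      ∃ j k, j < J ∧ ∑ l ∈ Finset.range j, (l + 2) * a l ≤ k ∧
        k + (j + 2) ≤ ∑ l ∈ Finset.range (j + 1), (l + 2) * a l ∧ k ≤ t ∧ t' < k + (j + 2) := by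
  induction J with
  | zero => exact ⟨fun _ => 0, by simp, by simp⟩
  | succ J ih =>
    obtain ⟨c, h1, h2⟩ := ih
    set S := ∑ l ∈ Finset.range J, (l + 2) * a l with hS
    set C := ∑ l ∈ Finset.range J, a l with hC
    refine ⟨fun t => if t < S then c t else C + (t - S) / (J + 2), ?_, ?_⟩
    · intro t ht
      rw [Finset.sum_range_succ, ← hS] at ht
      rw [Finset.sum_range_succ, ← hC]
      simp only
      split_ifs with hts
      · have := h1 t hts
        omega
      · have : (t - S) / (J + 2) < a J := by
          apply Nat.div_lt_of_lt_mul
          omega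
        omega
    · intro t t' htt ht' hc
      simp only at hc
      by_cases c1 : t' < S
      · rw [if_pos (by omega), if_pos c1] at hc
        obtain ⟨j, k, hj, hh⟩ := h2 t t' htt c1 hc
        exact ⟨j, k, by omega, hh⟩
      · by_cases c2 : t < S
        · rw [if_pos c2, if_neg c1] at hc
          have := h1 t c2
          have := Nat.le_add_right C ((t' - S) / (J + 2))
          exact absurd hc (by linarith)
        · rw [if_neg c2, if_neg c1] at hc
          have hq : (t - S) / (J + 2) = (t' - S) / (J + 2) := by omega
          rw [Finset.sum_range_succ, ← hS] at ht'
          have hlt : (t' - S) / (J + 2) < a J := by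
            apply Nat.div_lt_of_lt_mul
            omega
          refine ⟨J, S + (J + 2) * ((t' - S) / (J + 2)), by omega, by omega, ?_, ?_, ?_⟩
          · rw [Finset.sum_range_succ, ← hS]
            have := Nat.mul_le_mul_left (J + 2) (Nat.succ_le_of_lt hlt)
            rw [Nat.succ_eq_add_one, Nat.mul_add] at this
            omega
          · rw [← hq]
            have := Nat.mul_div_le (t - S) (J + 2)
            omega
          · have := Nat.lt_mul_div_succ (t' - S) (show 0 < J + 2 by omega)
            rw [Nat.mul_add] at this
            omega

theorem upper (N J : ℕ) (a : ℕ → ℕ) (hJ : 2 * (J + 2) ≤ N) (hJ' : N < 2 * (J + 3))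
    (h1 : ∀ j, j ≤ J → T N j ≤ ∑ l ∈ Finset.range (j + 1), (l + 2) * a l)
    (h2 : ∀ j, j ≤ J → ∑ l ∈ Finset.range (j + 1), (l + 2) * a l < T N j + (j + 2)) :
    ∃ g, Col N (∑ l ∈ Finset.range (J + 1), a l) g := by
  obtain ⟨c, c1, c2⟩ := exists_greedy a (J + 1)
  have hlt : ∀ d, IsD N d → enc N d < ∑ l ∈ Finset.range (J + 1), (l + 2) * a l :=
    fun d hd => lt_of_lt_of_le (enc_lt N J hJ hJ' d hd) (h1 J le_rfl)
  have main : ∀ d e, IsD N d → IsD N e → enc N d < enc N e → c (enc N d) = c (enc N e) →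
      Cr d e ∨ Cr e d := by
    intro d e hd he hde hc
    obtain ⟨j, k, hj, k1, k2, k3, k4⟩ := c2 _ _ hde (hlt e he) hc
    refine enc_cross N (j + 2) k (by omega) (by omega) d e hd he ?_ ?_ k3 hde k4
    · refine le_trans ?_ k1
      rw [show j + 2 - 2 = j by omega]
      cases j with
      | zero => simp
      | succ j =>
        refine le_trans ?_ (h1 j (by omega))
        unfold T
        rw [if_pos (by omega)]
    · have := h2 j (by omega)
      rw [show j + 2 - 1 = j + 1 by omega]
      have h3 : T N j ≤ (j + 1) * N := by
        unfold T
        split_ifs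
        · exact le_rfl
        · rw [Nat.add_mul]
          omega
      omega
  refine ⟨fun d => c (enc N d), fun d hd => c1 _ (hlt d hd), fun d e hd he hne hc => ?_⟩
  rcases lt_trichotomy (enc N d) (enc N e) with h | h | h
  · exact main d e hd he h hc
  · exact absurd (enc_inj hd he h) hne
  · exact (main e d he hd h hc.symm).symm

theorem exchange (N J : ℕ) (a x : ℕ → ℕ)
    (h1 : ∀ j, j < J → T N j ≤ ∑ l ∈ Finset.range (j + 1), (l + 2) * x l)
    (h2 : ∀ j, j < J → ∑ l ∈ Finset.range (j + 1), (l + 2) * a l < T N j + (j + 2)) :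
    ∑ l ∈ Finset.range J, a l ≤ ∑ l ∈ Finset.range J, x l ∧
    ∑ l ∈ Finset.range J, (l + 2) * x l + (J + 1) * ∑ l ∈ Finset.range J, a l ≤
      ∑ l ∈ Finset.range J, (l + 2) * a l + (J + 1) * ∑ l ∈ Finset.range J, x l := by
  induction J with
  | zero => simp
  | succ J ih =>
    obtain ⟨i1, i2⟩ := ih (fun j hj => h1 j (by omega)) (fun j hj => h2 j (by omega))
    have k1 := h1 J (by omega)
    have k2 := h2 J (by omega)
    simp only [Finset.sum_range_succ] at k1 k2 ⊢
    generalize ∑ l ∈ Finset.range J, (l + 2) * x l = X at *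
    generalize ∑ l ∈ Finset.range J, (l + 2) * a l = S at *
    generalize ∑ l ∈ Finset.range J, x l = c at *
    generalize ∑ l ∈ Finset.range J, a l = C at *
    have key : X + (J + 2) * x J + (J + 1 + 1) * (C + a J) ≤
      S + (J + 2) * a J + (J + 1 + 1) * (c + x J) := by nlinarith
    refine ⟨?_, key⟩
    by_contra hcon
    push Not at hcon
    have := Nat.mul_le_mul_left (J + 2) (Nat.succ_le_of_lt hcon)
    rw [Nat.succ_eq_add_one] at this
    nlinarith

theorem AB_spec (n j : ℕ) (hj : j < (n + 1) / 2) :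
    (assocAB n j).2 = j * (n + 3) - ∑ l ∈ Finset.range j, ((l : ℤ) + 2) * (assocAB n l).1 ∧
    1 ≤ (assocAB n j).1 ∧
    (T (n + 3) j : ℤ) ≤ ∑ l ∈ Finset.range (j + 1), ((l : ℤ) + 2) * (assocAB n l).1 ∧
    ∑ l ∈ Finset.range (j + 1), ((l : ℤ) + 2) * (assocAB n l).1 < (T (n + 3) j : ℤ) + (j + 2) := by
  have hA : (assocAB n j).1 = if 2 * (j + 2) < n + 3 then
      ⌈((n : ℚ) + 3 + ((assocAB n j).2 : ℚ)) / ((j : ℚ) + 2)⌉ else 1 := by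
    cases j with
    | zero =>
      simp only [assocAB]
      by_cases h : n % 2 = 0 ∨ 2 ≤ (n + 1) / 2
      · rw [if_pos h, if_pos (by omega)]; simp
      · rw [if_neg h, if_neg (by omega)]
    | succ j =>
      simp only [assocAB]
      by_cases h : n % 2 = 0 ∨ j + 3 ≤ (n + 1) / 2
      · rw [if_pos h, if_pos (by omega)]
        push_cast
        congr 2
        ring
      · rw [if_neg h, if_neg (by omega)]
  have hB : (assocAB n j).2 = j * (n + 3) -
      ∑ l ∈ Finset.range j, ((l : ℤ) + 2) * (assocAB n l).1 ∧
      (assocAB n j).2 ≤ 0 ∧ - (j + 1 : ℤ) < (assocAB n j).2 := by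
    cases j with
    | zero => simp [assocAB]
    | succ j =>
      obtain ⟨b1, b2, b3, b4⟩ := AB_spec n j (by omega)
      have hT : T (n + 3) j = (j + 1) * (n + 3) := by unfold T; rw [if_pos (by omega)]
      rw [hT] at b3 b4
      push_cast at b3 b4
      have e : (assocAB n (j + 1)).2 = (n : ℤ) + 3 + (assocAB n j).2 -
        ((j : ℤ) + 2) * (assocAB n j).1 := rfl
      have e' : (assocAB n (j + 1)).2 = ((j + 1 : ℕ) : ℤ) * (n + 3) -
          ∑ l ∈ Finset.range (j + 1), ((l : ℤ) + 2) * (assocAB n l).1 := by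
        rw [e, b1, Finset.sum_range_succ]
        push_cast
        ring
      refine ⟨e', ?_, ?_⟩
      · rw [e']; push_cast; linarith
      · rw [e']; push_cast; linarith
  obtain ⟨b1, b2, b3⟩ := hB
  rw [Finset.sum_range_succ]
  have b1' : ∑ l ∈ Finset.range j, ((l : ℤ) + 2) * (assocAB n l).1
    = j * (n + 3) - (assocAB n j).2 := by linarith
  refine ⟨b1, ?_⟩
  rw [b1']
  generalize (assocAB n j).1 = A at *
  generalize (assocAB n j).2 = B at *
  unfold T
  by_cases h : 2 * (j + 2) < n + 3
  · rw [if_pos h] at hA ⊢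
    have hpos : (0 : ℚ) < (j : ℚ) + 2 := by positivity
    have c1 := Int.le_ceil (((n : ℚ) + 3 + (B : ℚ)) / ((j : ℚ) + 2))
    have c2 := Int.ceil_lt_add_one (((n : ℚ) + 3 + (B : ℚ)) / ((j : ℚ) + 2))
    rw [← hA] at c1 c2
    rw [div_le_iff₀ hpos] at c1
    rw [← sub_lt_iff_lt_add, lt_div_iff₀ hpos] at c2
    have c1' : (n : ℤ) + 3 + B ≤ A * (j + 2) := by exact_mod_cast c1
    have c2' : (A - 1) * ((j : ℤ) + 2) < (n : ℤ) + 3 + B := by exact_mod_cast c2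
    push_cast
    refine ⟨?_, by linarith, by linarith⟩
    by_contra hcon
    have : A * ((j : ℤ) + 2) ≤ 0 := mul_nonpos_of_nonpos_of_nonneg (by omega) (by omega)
    omega
  · rw [if_neg h] at hA ⊢
    subst hA
    push_cast
    refine ⟨by norm_num, by linarith, by linarith⟩

theorem class_card (N : ℕ) (P : Finset (ℕ × ℕ)) (hP : ∀ d ∈ P, IsD N d)
    (hc : ∀ d ∈ P, ∀ e ∈ P, d ≠ e → Cr d e ∨ Cr e d) (d0 : ℕ × ℕ) (h0 : d0 ∈ P) :
    P.card ≤ len N d0 := by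
  have i0 := hP d0 h0
  unfold len
  apply le_min
  · have : P.card ≤ (Finset.Ico d0.1 d0.2).card := by
      apply Finset.card_le_card_of_injOn (fun d => if d0.1 ≤ d.1 ∧ d.1 < d0.2 then d.1 else d.2)
      · intro d hd
        have hd : d ∈ P := hd
        have id := hP d hd
        simp only [Finset.coe_Ico, Set.mem_Ico]
        by_cases he : d = d0
        · subst he
          unfold IsD at id
          split_ifs <;> omega
        · have := hc d hd d0 h0 he
          unfold Cr at this
          split_ifs <;> omega
      · intro d hd e he h
        have hd : d ∈ P := hd
        have he : e ∈ P := he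
        by_contra hne
        have := hc d hd e he hne
        simp only at h
        unfold Cr at this
        split_ifs at h <;> omega
    simpa using this
  · have hcard : (Finset.range N \ Finset.Ico d0.1 d0.2).card = N - (d0.2 - d0.1) := by
      rw [Finset.card_sdiff_of_subset]
      · simp
      · intro x hx
        unfold IsD at i0
        simp only [Finset.mem_Ico, Finset.mem_range] at *
        omega
    rw [← hcard]
    apply Finset.card_le_card_of_injOn (fun d => if d0.1 ≤ d.1 ∧ d.1 < d0.2 then d.2 else d.1)
    · intro d hd
      have hd : d ∈ P := hd
      have id := hP d hd
      simp only [Finset.mem_coe, Finset.mem_sdiff, Finset.mem_range, Finset.mem_Ico]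
      unfold IsD at id
      by_cases he : d = d0
      · subst he
        split_ifs <;> omega
      · have := hc d hd d0 h0 he
        unfold Cr at this
        split_ifs <;> omega
    · intro d hd e he h
      have hd : d ∈ P := hd
      have he : e ∈ P := he
      have id := hP d hd
      have ie := hP e he
      by_contra hne
      have := hc d hd e he hne
      simp only at h
      unfold Cr at this
      split_ifs at h <;> omega

open Classical in
/-- The set of all diagonals. -/
noncomputable def Dg (N : ℕ) : Finset (ℕ × ℕ) :=
  (Finset.range N ×ˢ Finset.range N).filter (IsD N)

theorem mem_Dg (N : ℕ) (d : ℕ × ℕ) : d ∈ Dg N ↔ IsD N d := by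
  unfold Dg
  simp only [Finset.mem_filter, Finset.mem_product, Finset.mem_range]
  constructor
  · exact fun h => h.2
  · intro h
    refine ⟨?_, h⟩
    unfold IsD at h
    omega

theorem T_le (N j : ℕ) (hj : 2 * (j + 2) ≤ N) :
    T N j ≤ ((Dg N).filter (fun d => len N d ≤ j + 2)).card := by
  have : (Finset.range (T N j)).card ≤ ((Dg N).filter (fun d => len N d ≤ j + 2)).card := by
    apply Finset.card_le_card_of_surjOn (enc N)
    intro t ht
    simp only [Finset.coe_range, Set.mem_Iio] at ht
    simp only [Finset.coe_filter, mem_Dg, Set.mem_image, Set.mem_setOf_eq]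
    have hN : 0 < N := by omega
    obtain ⟨l, s, hs, rfl⟩ : ∃ l s, s < N ∧ t = l * N + s :=
      ⟨t / N, t % N, Nat.mod_lt _ hN, by rw [Nat.mul_comm]; exact (Nat.div_add_mod t N).symm⟩
    have hl : l ≤ j ∧ (N = 2 * (l + 2) → s < l + 2) := by
      have hlj : l ≤ j := by
        by_contra hcon
        have h1 : (j + 1) * N ≤ l * N := Nat.mul_le_mul_right _ (by omega)
        unfold T at ht
        split_ifs at ht
        · omega
        · rw [Nat.add_mul] at h1
          omega
      refine ⟨hlj, fun h => ?_⟩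
      have : l = j := by omega
      subst this
      unfold T at ht
      rw [if_neg (by omega)] at ht
      omega
    by_cases c : s + l + 2 < N
    · refine ⟨(s, s + l + 2), ⟨?_, ?_⟩, ?_⟩
      · unfold IsD; simp only; omega
      · unfold len; simp only; omega
      · unfold enc
        simp only
        rw [if_pos (by omega), show s + l + 2 - s - 2 = l by omega]
    · refine ⟨(s + l + 2 - N, s), ⟨?_, ?_⟩, ?_⟩
      · unfold IsD; simp only; omega
      · unfold len; simp only; omega
      · unfold enc
        simp only
        rw [if_neg (by omega), show N - (s - (s + l + 2 - N)) - 2 = l by omega]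
  simpa using this

theorem lower (N J m : ℕ) (g : ℕ × ℕ → ℕ) (hg : Col N m g) (hJ : 2 * (J + 1) ≤ N) :
    ∃ x : ℕ → ℕ, (∀ j, j < J → T N j ≤ ∑ l ∈ Finset.range (j + 1), (l + 2) * x l) ∧
      ∑ l ∈ Finset.range J, x l ≤ m := by
  classical
  obtain ⟨g1, g2⟩ := hg
  set μ : ℕ → ℕ := fun c => sInf (len N '' {d | IsD N d ∧ g d = c}) with hμ
  have mu_le : ∀ d, IsD N d → μ (g d) ≤ len N d := fun d hd =>
    Nat.sInf_le ⟨d, ⟨hd, rfl⟩, rfl⟩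
  have mu_mem : ∀ d, IsD N d → ∃ e, IsD N e ∧ g e = g d ∧ len N e = μ (g d) := by
    intro d hd
    have : μ (g d) ∈ (len N '' {e | IsD N e ∧ g e = g d}) := Nat.sInf_mem ⟨_, d, ⟨hd, rfl⟩, rfl⟩
    obtain ⟨e, ⟨h1, h2⟩, h3⟩ := this
    exact ⟨e, h1, h2, h3⟩
  have len_ge : ∀ d, IsD N d → 2 ≤ len N d := by
    intro d hd
    unfold IsD at hd
    unfold len
    omega
  refine ⟨fun l => ((Finset.range m).filter (fun c => μ c = l + 2)).card, ?_, ?_⟩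
  · intro j hj
    refine le_trans (T_le N j (by omega)) ?_
    have hsub : (Dg N).filter (fun d => len N d ≤ j + 2) ⊆
        (Finset.range (j + 1)).biUnion (fun l => (Dg N).filter (fun d => μ (g d) = l + 2)) := by
      intro d hd
      simp only [Finset.mem_filter, mem_Dg, Finset.mem_biUnion, Finset.mem_range] at hd ⊢
      obtain ⟨e, e1, e2, e3⟩ := mu_mem d hd.1
      have := len_ge e e1
      have := mu_le d hd.1
      exact ⟨μ (g d) - 2, by omega, hd.1, by omega⟩
    refine le_trans (Finset.card_le_card hsub) (le_trans Finset.card_biUnion_le ?_)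
    apply Finset.sum_le_sum
    intro l hl
    apply Finset.card_le_mul_card_image_of_maps_to (f := g)
    · intro d hd
      simp only [Finset.mem_filter, mem_Dg, Finset.mem_range] at hd ⊢
      exact ⟨g1 d hd.1, hd.2⟩
    · intro c hc
      simp only [Finset.mem_filter, Finset.mem_range] at hc
      rcases Finset.eq_empty_or_nonempty
        (((Dg N).filter (fun d => μ (g d) = l + 2)).filter (fun d => g d = c)) with h | ⟨d, hd⟩
      · rw [h]; simp
      · simp only [Finset.mem_filter, mem_Dg] at hd
        obtain ⟨⟨d1, d2⟩, d3⟩ := hd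
        obtain ⟨e, e1, e2, e3⟩ := mu_mem d d1
        rw [← d2, ← e3]
        apply class_card
        · intro d' hd'
          simp only [Finset.mem_filter, mem_Dg] at hd'
          exact hd'.1.1
        · intro d' hd' e' he' hne
          simp only [Finset.mem_filter, mem_Dg] at hd' he'
          exact g2 _ _ hd'.1.1 he'.1.1 hne (by rw [hd'.2, he'.2])
        · simp only [Finset.mem_filter, mem_Dg]
          exact ⟨⟨e1, by rw [e2, e3]⟩, by rw [e2, d3]⟩
  · rw [← Finset.card_biUnion]
    · calc _ ≤ (Finset.range m).card := Finset.card_le_card (by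
            intro c hc
            simp only [Finset.mem_filter, Finset.mem_biUnion] at hc
            obtain ⟨_, _, h, _⟩ := hc
            exact h)
        _ = m := by simp
    · intro l _ l' _ hne
      rw [Function.onFun, Finset.disjoint_left]
      intro c h h'
      simp only [Finset.mem_filter] at h h'
      omega

end AssocAux

/-- Theorem 1: the chromatic number of the `n`-dimensional associahedron equals
`Σ_{i=2}^{⌈n/2⌉+1} A_i`. -/
theorem assocChromatic_eq_sum_A (n : ℕ) (hn : 1 ≤ n) :
    (assocChromatic n : ℤ) = ∑ i ∈ Finset.Icc 2 ((n + 1) / 2 + 1), assocA n i := by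
  obtain ⟨J, hJ⟩ : ∃ J, (n + 1) / 2 = J + 1 := ⟨(n + 1) / 2 - 1, by omega⟩
  have spec := AssocAux.AB_spec n
  rw [hJ] at spec ⊢
  set a : ℕ → ℕ := fun l => ((assocAB n l).1).toNat with ha
  have hcast : ∀ l, l < J + 1 → (assocAB n l).1 = (a l : ℤ) := by
    intro l hl
    have := (spec l hl).2.1
    simp only [ha]
    omega
  have hsum : ∀ j, j ≤ J → ∑ l ∈ Finset.range (j + 1), ((l : ℤ) + 2) * (assocAB n l).1
      = ((∑ l ∈ Finset.range (j + 1), (l + 2) * a l : ℕ) : ℤ) := by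
    intro j hj
    push_cast
    apply Finset.sum_congr rfl
    intro l hl
    rw [Finset.mem_range] at hl
    rw [hcast l (by omega)]
  have h1 : ∀ j, j ≤ J →
      AssocAux.T (n + 3) j ≤ ∑ l ∈ Finset.range (j + 1), (l + 2) * a l := by
    intro j hj
    have := (spec j (by omega)).2.2.1
    rw [hsum j hj] at this
    exact_mod_cast this
  have h2 : ∀ j, j ≤ J →
      ∑ l ∈ Finset.range (j + 1), (l + 2) * a l < AssocAux.T (n + 3) j + (j + 2) := by
    intro j hj
    have := (spec j (by omega)).2.2.2
    rw [hsum j hj] at this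
    exact_mod_cast this
  have hR : ∑ i ∈ Finset.Icc 2 (J + 1 + 1), assocA n i
      = ((∑ l ∈ Finset.range (J + 1), a l : ℕ) : ℤ) := by
    rw [← Finset.Ico_add_one_right_eq_Icc, Finset.sum_Ico_eq_sum_range]
    push_cast
    apply Finset.sum_congr (by congr 1)
    intro l hl
    rw [Finset.mem_range] at hl
    unfold assocA
    rw [show 2 + l - 2 = l by omega, hcast l (by omega)]
  rw [hR]
  norm_cast
  unfold assocChromatic
  simp only [AssocAux.exists_col_iff]
  apply le_antisymm
  · exact Nat.sInf_le (AssocAux.upper (n + 3) J a (by omega) (by omega) h1 h2)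
  · apply le_csInf
    · exact ⟨_, AssocAux.upper (n + 3) J a (by omega) (by omega) h1 h2⟩
    · rintro m ⟨g, hg⟩
      obtain ⟨x, x1, x2⟩ := AssocAux.lower (n + 3) (J + 1) m g hg (by omega)
      exact le_trans (AssocAux.exchange (n + 3) (J + 1) a x x1 (fun j hj => h2 j (by omega))).1 x2
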